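/- arXiv:1010.0606 — 2 statements merged into one kernel-verified Lean document; each statement's English description precedes it below -/
import Mathlib

section
/- Let Γ be a finite simple graph whose largest clique has exactly n vertices. Then the least common multiple of the orders of the finite subgroups of the right-angled Coxeter group W_Γ is 2^n; that is, every finite subgroup of W_Γ has order dividing 2^n, and W_Γ contains a subgroup of order 2^n. -/
/-- Relations of the right-angled Coxeter group: squares of the generators and
commutators of adjacent generators. -/
def racgRels {V : Type} (Γ : SimpleGraph V) : Set (FreeGroup V) :=
  {r | ∃ s : V, r = FreeGroup.of s * FreeGroup.of s} ∪
  {r | ∃ s t : V, Γ.Adj s t ∧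
    r = FreeGroup.of s * FreeGroup.of t * (FreeGroup.of s)⁻¹ * (FreeGroup.of t)⁻¹}

/-- The right-angled Coxeter group of a simple graph. -/
abbrev RACG {V : Type} (Γ : SimpleGraph V) : Type := PresentedGroup (racgRels Γ)

namespace RACG

variable {V : Type} {Γ : SimpleGraph V}

/-- The canonical generator of `RACG Γ` attached to a vertex. -/
def gen (Γ : SimpleGraph V) (v : V) : RACG Γ := PresentedGroup.of v

lemma gen_mul_self (v : V) : gen Γ v * gen Γ v = 1 :=
  PresentedGroup.one_of_mem (rels := racgRels Γ) (Or.inl ⟨v, rfl⟩)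

lemma gen_inv (v : V) : (gen Γ v)⁻¹ = gen Γ v :=
  inv_eq_of_mul_eq_one_left (gen_mul_self v)

lemma gen_commute {u v : V} (h : Γ.Adj u v) : Commute (gen Γ u) (gen Γ v) := by
  have h1 : gen Γ u * gen Γ v * (gen Γ u)⁻¹ * (gen Γ v)⁻¹ = 1 :=
    PresentedGroup.one_of_mem (rels := racgRels Γ) (Or.inr ⟨u, v, h, rfl⟩)
  exact mul_inv_eq_iff_eq_mul.1 (mul_inv_eq_one.1 h1)

/-- The universal property of `RACG Γ`. -/
def lift {G : Type*} [Group G] (f : V → G) (hsq : ∀ v, f v * f v = 1)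
    (hcomm : ∀ u v, Γ.Adj u v → Commute (f u) (f v)) : RACG Γ →* G :=
  PresentedGroup.toGroup (f := f) (by
    rintro r (⟨s, rfl⟩ | ⟨s, t, hst, rfl⟩)
    · simp [hsq]
    · simp [(hcomm s t hst).eq])

@[simp] lemma lift_gen {G : Type*} [Group G] (f : V → G) (hsq : ∀ v, f v * f v = 1)
    (hcomm : ∀ u v, Γ.Adj u v → Commute (f u) (f v)) (v : V) :
    lift f hsq hcomm (gen Γ v) = f v :=
  PresentedGroup.toGroup.of _

lemma hom_ext {G : Type*} [Group G] {f g : RACG Γ →* G}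
    (h : ∀ v, f (gen Γ v) = g (gen Γ v)) : f = g :=
  PresentedGroup.ext h

lemma closure_range_gen (Γ : SimpleGraph V) : Subgroup.closure (Set.range (gen Γ)) = ⊤ :=
  PresentedGroup.closure_range_of _

/-- The homomorphism out of the group of order two determined by an involution. -/
def involutionHom {G : Type*} [Group G] (g : G) (hg : g * g = 1) : ℤˣ →* G where
  toFun x := if x = 1 then 1 else g
  map_one' := if_pos rfl
  map_mul' x y := by
    rcases Int.units_eq_one_or x with rfl | rfl <;>
      rcases Int.units_eq_one_or y with rfl | rfl <;> simp [hg]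

lemma involutionHom_neg_one {G : Type*} [Group G] (g : G) (hg : g * g = 1) :
    involutionHom g hg (-1) = g :=
  show (if (-1 : ℤˣ) = 1 then 1 else g) = g from if_neg (by decide)

/-- The sign homomorphism detecting one vertex. -/
noncomputable def detect (Γ : SimpleGraph V) (c : V) : RACG Γ →* ℤˣ :=
  open Classical in
  lift (fun v => if v = c then -1 else 1) (fun v => by split_ifs <;> simp)
    (fun _ _ _ => mul_comm _ _)

@[simp] lemma detect_self (c : V) : detect Γ c (gen Γ c) = -1 :=
  (lift_gen _ _ _ _).trans (if_pos rfl)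

lemma detect_of_ne {c v : V} (h : v ≠ c) : detect Γ c (gen Γ v) = 1 :=
  (lift_gen _ _ _ _).trans (if_neg h)

/-- The homomorphism sending every generator to `-1`. -/
def parity (Γ : SimpleGraph V) : RACG Γ →* ℤˣ :=
  lift (fun _ => -1) (fun _ => by simp) (fun _ _ _ => mul_comm _ _)

@[simp] lemma parity_gen (v : V) : parity Γ (gen Γ v) = -1 :=
  lift_gen _ _ _ _

section FreeProduct

variable {C : Type}

lemma exists_reduced_word (g : RACG (⊥ : SimpleGraph C)) :
    ∃ l : List C, l.IsChain (· ≠ ·) ∧ (l.map (gen ⊥)).prod = g := by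
  have key (c : C) (y : RACG (⊥ : SimpleGraph C))
      (hy : ∃ l : List C, l.IsChain (· ≠ ·) ∧ (l.map (gen ⊥)).prod = y) :
      ∃ l : List C, l.IsChain (· ≠ ·) ∧ (l.map (gen ⊥)).prod = gen ⊥ c * y := by
    obtain ⟨l, hl, rfl⟩ := hy
    cases l with
    | nil => exact ⟨[c], by simp, by simp⟩
    | cons a m =>
      by_cases hca : c = a
      · subst hca
        exact ⟨m, hl.tail, by simp [← mul_assoc, gen_mul_self]⟩
      · exact ⟨c :: a :: m, List.isChain_cons_cons.2 ⟨hca, hl⟩, by simp⟩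
  have hg : g ∈ Subgroup.closure (Set.range (gen (⊥ : SimpleGraph C))) := by
    simp [closure_range_gen]
  induction hg using Subgroup.closure_induction_left with
  | one => exact ⟨[], by simp, by simp⟩
  | mul_left x hx y hy ih =>
    obtain ⟨c, rfl⟩ := hx
    exact key c y ih
  | inv_mul_cancel x hx y hy ih =>
    obtain ⟨c, rfl⟩ := hx
    rw [gen_inv]
    exact key c y ih

lemma prod_reduced_ne_one {l : List C} (hl : l.IsChain (· ≠ ·)) (hne : l ≠ []) :
    (l.map (gen (⊥ : SimpleGraph C))).prod ≠ 1 := by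
  classical
  intro h
  let F : RACG (⊥ : SimpleGraph C) →* Monoid.CoprodI (fun _ : C => ℤˣ) :=
    lift (fun c => Monoid.CoprodI.of (i := c) (-1 : ℤˣ)) (fun c => by rw [← map_mul]; simp)
      (fun _ _ h => h.elim)
  let w : Monoid.CoprodI.Word (fun _ : C => ℤˣ) :=
    { toList := l.map fun c => ⟨c, -1⟩
      ne_one := by
        intro x hx
        obtain ⟨c, -, rfl⟩ := List.mem_map.1 hx
        exact show (-1 : ℤˣ) ≠ 1 by decide
      chain_ne := (List.isChain_map _).2 hl }
  have hw : w.prod = 1 := by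
    rw [← map_one F, ← h, map_list_prod, List.map_map]
    simp only [Monoid.CoprodI.Word.prod, w, List.map_map]
    congr 1
  have hw' : w = Monoid.CoprodI.Word.empty := by
    apply Monoid.CoprodI.Word.equiv.symm.injective
    change w.prod = Monoid.CoprodI.Word.prod _
    rw [hw, Monoid.CoprodI.Word.prod_empty]
  have := congrArg Monoid.CoprodI.Word.toList hw'
  exact hne (List.map_eq_nil_iff.1 this)

lemma not_isOfFinOrder_of_cyclically_reduced {l : List C} (hl : l.IsChain (· ≠ ·)) (hne : l ≠ [])
    (hcyc : ∀ x ∈ l.getLast?, ∀ y ∈ l.head?, x ≠ y) :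
    ¬ IsOfFinOrder (l.map (gen (⊥ : SimpleGraph C))).prod := by
  rw [isOfFinOrder_iff_pow_eq_one]
  rintro ⟨k, hk, h⟩
  have hchain : (List.replicate k l).flatten.IsChain (· ≠ ·) := by
    rw [List.isChain_flatten (by simp [List.mem_replicate, hne.symm])]
    refine ⟨fun m hm => (List.eq_of_mem_replicate hm) ▸ hl, ?_⟩
    exact List.isChain_replicate_of_rel _ hcyc
  refine prod_reduced_ne_one hchain ?_ ?_
  · simp [List.flatten_eq_nil_iff, List.mem_replicate, hk.ne', hne]
  · rw [← h, List.map_flatten, List.prod_flatten]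
    simp

lemma eq_one_or_isConj_gen_of_isOfFinOrder (g : RACG (⊥ : SimpleGraph C)) (hg : IsOfFinOrder g) :
    g = 1 ∨ ∃ c x, g = x * gen ⊥ c * x⁻¹ := by
  obtain ⟨l, hl, rfl⟩ := exists_reduced_word g
  induction l using List.bidirectionalRec with
  | nil => simp
  | singleton a => exact Or.inr ⟨a, 1, by simp⟩
  | cons_append a l b ih =>
    by_cases hab : a = b
    · subst hab
      have hl' : l.IsChain (· ≠ ·) := (List.isChain_append.1 hl.tail).1
      have hprod : ((a :: (l ++ [a])).map (gen (⊥ : SimpleGraph C))).prod =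
          gen ⊥ a * (l.map (gen ⊥)).prod * (gen ⊥ a)⁻¹ := by
        simp [gen_inv, mul_assoc]
      rw [hprod] at hg ⊢
      have hfin : IsOfFinOrder (l.map (gen (⊥ : SimpleGraph C))).prod := by
        rw [← MulAut.conj_apply] at hg
        exact (Function.Injective.isOfFinOrder_iff
          (f := (MulAut.conj (gen ⊥ a)).toMonoidHom) (MulAut.conj (gen ⊥ a)).injective).1 hg
      rcases ih hl' hfin with h | ⟨c, x, h⟩
      · left; simp [h]
      · right
        exact ⟨c, gen ⊥ a * x, by rw [h]; group⟩
    · refine absurd hg (not_isOfFinOrder_of_cyclically_reduced hl (by simp) ?_)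
      intro x hx y hy
      rw [← List.cons_append, List.getLast?_concat] at hx
      simp only [List.head?_cons, Option.mem_def, Option.some.injEq] at hx hy
      subst hx hy
      exact Ne.symm hab

lemma parity_of_isOfFinOrder {g : RACG (⊥ : SimpleGraph C)} (hg : IsOfFinOrder g) (h1 : g ≠ 1) :
    parity ⊥ g = -1 := by
  obtain ⟨c, x, rfl⟩ := (eq_one_or_isConj_gen_of_isOfFinOrder g hg).resolve_left h1
  simp

lemma eq_of_mem_finite {N : Subgroup (RACG (⊥ : SimpleGraph C))} [Finite N]
    {g h : RACG (⊥ : SimpleGraph C)} (hg : g ∈ N) (hh : h ∈ N) (hg1 : g ≠ 1) (hh1 : h ≠ 1) :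
    g = h := by
  have fin (x) (hx : x ∈ N) : IsOfFinOrder x :=
    Submonoid.isOfFinOrder_coe.2 (isOfFinOrder_of_finite (⟨x, hx⟩ : N))
  by_contra hne
  have h2 := parity_of_isOfFinOrder (fin _ (N.mul_mem hg (N.inv_mem hh)))
    (fun h => hne (mul_inv_eq_one.1 h))
  rw [map_mul, map_inv, parity_of_isOfFinOrder (fin _ hg) hg1,
    parity_of_isOfFinOrder (fin _ hh) hh1] at h2
  exact absurd h2 (by decide)

/-- The endomorphism of the free product of groups of order two permuting the generators by `k`. -/
def permHom {K : Type} [Group K] [MulAction K C] (k : K) :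
    RACG (⊥ : SimpleGraph C) →* RACG (⊥ : SimpleGraph C) :=
  lift (fun c => gen ⊥ (k • c)) (fun _ => gen_mul_self _) (fun _ _ h => h.elim)

lemma permHom_gen {K : Type} [Group K] [MulAction K C] (k : K) (c : C) :
    permHom k (gen ⊥ c) = gen ⊥ (k • c) :=
  lift_gen _ _ _ _

lemma permHom_mul {K : Type} [Group K] [MulAction K C] (k k' : K) :
    permHom (C := C) (k * k') = (permHom k).comp (permHom k') :=
  hom_ext fun c => by simp [permHom_gen, mul_smul]

lemma permHom_one (K : Type) [Group K] [MulAction K C] :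
    permHom (C := C) (1 : K) = MonoidHom.id _ :=
  hom_ext fun c => by simp [permHom_gen]

/-- The action of `K` on the free product of groups of order two indexed by a `K`-set. -/
def permAut (K : Type) [Group K] (C : Type) [MulAction K C] :
    K →* MulAut (RACG (⊥ : SimpleGraph C)) where
  toFun k := (permHom k).toMulEquiv (permHom k⁻¹)
    (by rw [← permHom_mul, inv_mul_cancel, permHom_one])
    (by rw [← permHom_mul, mul_inv_cancel, permHom_one])
  map_one' := MulEquiv.ext fun x => DFunLike.congr_fun (permHom_one K) x
  map_mul' k k' := MulEquiv.ext fun x => DFunLike.congr_fun (permHom_mul k k') x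

lemma permAut_gen {K : Type} [Group K] [MulAction K C] (k : K) (c : C) :
    permAut K C k (gen ⊥ c) = gen ⊥ (k • c) :=
  permHom_gen k c

lemma card_ker_mul_card_map {G G' : Type*} [Group G] [Group G'] (f : G →* G') (H : Subgroup G) :
    Nat.card (f.comp H.subtype).ker * Nat.card (H.map f) = Nat.card H := by
  rw [← (f.comp H.subtype).ker.card_mul_index, Subgroup.index_ker, MonoidHom.range_comp,
    Subgroup.range_subtype]

lemma finite_map {G G' : Type*} [Group G] [Group G'] (f : G →* G') (H : Subgroup G) [Finite H] :
    Finite (H.map f) :=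
  ((Set.toFinite (H : Set G)).image f).to_subtype

lemma card_map_of_injOn {G G' : Type*} [Group G] [Group G'] (f : G →* G') (H : Subgroup G)
    (h : ∀ x ∈ H, f x = 1 → x = 1) : Nat.card (H.map f) = Nat.card H := by
  have hker : (f.comp H.subtype).ker = ⊥ := by
    rw [eq_bot_iff]
    rintro ⟨x, hx⟩ hfx
    exact Subtype.ext (h x hx hfx)
  rw [← card_ker_mul_card_map f H, hker, Subgroup.card_bot, one_mul]

lemma card_finite_subgroup_semidirect {K : Type} [Group K] [MulAction K C]
    (H : Subgroup (RACG (⊥ : SimpleGraph C) ⋊[permAut K C] K)) [Finite H] :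
    Nat.card H = Nat.card (H.map SemidirectProduct.rightHom) ∨
      ∃ c : C, Nat.card H = 2 * Nat.card (H.map SemidirectProduct.rightHom) ∧
        ∀ k ∈ H.map SemidirectProduct.rightHom, k • c = c := by
  let i : RACG (⊥ : SimpleGraph C) →* RACG (⊥ : SimpleGraph C) ⋊[permAut K C] K :=
    SemidirectProduct.inl
  have hi : Function.Injective i := SemidirectProduct.inl_injective
  let N := H.comap i
  have : Finite N :=
    Finite.of_injective (fun x : N => (⟨i x, x.2⟩ : H))
      fun x y h => Subtype.ext (hi (congrArg Subtype.val h))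
  have hright (y : RACG (⊥ : SimpleGraph C) ⋊[permAut K C] K)
      (hy : SemidirectProduct.rightHom y = 1) : ∃ g, i g = y :=
    ⟨y.left, SemidirectProduct.ext rfl hy.symm⟩
  by_cases hN : ∀ g ∈ N, g = 1
  · left
    refine (card_map_of_injOn _ _ fun y hy hy1 => ?_).symm
    obtain ⟨g, rfl⟩ := hright y hy1
    rw [hN g hy, map_one]
  · right
    push Not at hN
    obtain ⟨g, hgN, hg1⟩ := hN
    have hfin : IsOfFinOrder g :=
      Submonoid.isOfFinOrder_coe.2 (isOfFinOrder_of_finite (⟨g, hgN⟩ : N))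
    obtain ⟨c, x, hgx⟩ := (eq_one_or_isConj_gen_of_isOfFinOrder g hfin).resolve_left hg1
    refine ⟨c, ?_, ?_⟩
    · rw [← card_ker_mul_card_map SemidirectProduct.rightHom H]
      congr 1
      rw [Nat.card_eq_two_iff]
      have hker : (⟨i g, hgN⟩ : H) ∈
          ((SemidirectProduct.rightHom (φ := permAut K C)).comp H.subtype).ker :=
        SemidirectProduct.rightHom_inl (φ := permAut K C) g
      refine ⟨1, ⟨⟨i g, hgN⟩, hker⟩, ?_, ?_⟩
      · intro h
        apply hg1
        apply hi
        rw [map_one]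
        exact (congrArg (fun z => ((z : H) : RACG (⊥ : SimpleGraph C) ⋊[permAut K C] K))
          (congrArg Subtype.val h)).symm
      · refine Set.eq_univ_of_forall ?_
        rintro ⟨⟨y, hy⟩, hy1⟩
        obtain ⟨g', rfl⟩ := hright y hy1
        by_cases hg' : g' = 1
        · left
          subst hg'
          exact Subtype.ext (Subtype.ext (map_one i))
        · right
          have := eq_of_mem_finite (N := N) (show g' ∈ N from hy) hgN hg' hg1
          subst this
          rfl
    · rintro k ⟨y, hy, rfl⟩
      have hconj : y * i g * y⁻¹ = i (y.left * permAut K C y.right g * y.left⁻¹) := by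
        conv_lhs => rw [← SemidirectProduct.inl_left_mul_inr_right y]
        simp only [i, map_mul, SemidirectProduct.inl_aut, map_inv, mul_inv_rev, mul_assoc]
      have hmem : y.left * permAut K C y.right g * y.left⁻¹ ∈ N := by
        change i _ ∈ H
        rw [← hconj]
        exact H.mul_mem (H.mul_mem hy hgN) (H.inv_mem hy)
      have hne : y.left * permAut K C y.right g * y.left⁻¹ ≠ 1 := by
        simpa [conj_eq_one_iff] using hg1
      have heq := eq_of_mem_finite hmem hgN hne hg1
      by_contra hkc
      have h2 := congrArg (detect ⊥ c) heq
      have h3 : detect ⊥ c (gen ⊥ (y.right • c)) = 1 := detect_of_ne hkc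
      simp only [hgx, map_mul, map_inv, permAut_gen, h3, detect_self] at h2
      simp [mul_comm] at h2

end FreeProduct

section VertexSplitting

variable (Γ) (v : V)

/-- The subgroup generated by the link of `v` in the group of the graph with `v` removed. -/
def linkSubgroup : Subgroup (RACG (Γ.induce {u | u ≠ v})) :=
  Subgroup.closure {g | ∃ u : {u | u ≠ v}, Γ.Adj v u ∧ g = gen _ u}

/-- The natural map from the group of the graph with `v` removed. -/
def deleteHom : RACG (Γ.induce {u | u ≠ v}) →* RACG Γ :=
  lift (fun u => gen Γ u) (fun _ => gen_mul_self _) (fun _ _ h => gen_commute h)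

lemma deleteHom_gen (u : {u | u ≠ v}) : deleteHom Γ v (gen _ u) = gen Γ u :=
  lift_gen _ _ _ _

lemma commute_deleteHom_of_mem {w : RACG (Γ.induce {u | u ≠ v})} (hw : w ∈ linkSubgroup Γ v) :
    Commute (deleteHom Γ v w) (gen Γ v) := by
  induction hw using Subgroup.closure_induction with
  | mem x hx =>
    obtain ⟨u, hu, rfl⟩ := hx
    rw [deleteHom_gen]
    exact (gen_commute hu).symm
  | one => simp
  | mul x y _ _ hx hy => rw [map_mul]; exact hx.mul_left hy
  | inv x _ hx => rw [map_inv]; exact hx.inv_left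

/-- The generators of the kernel of the map killing `v`, indexed by cosets of the link subgroup. -/
noncomputable def cosetHom :
    RACG (⊥ : SimpleGraph (RACG (Γ.induce {u | u ≠ v}) ⧸ linkSubgroup Γ v)) →* RACG Γ :=
  lift (fun c => MulAut.conj (deleteHom Γ v c.out) (gen Γ v))
    (fun _ => by rw [← map_mul, gen_mul_self, map_one]) (fun _ _ h => h.elim)

lemma cosetHom_gen_mk (w : RACG (Γ.induce {u | u ≠ v})) :
    cosetHom Γ v (gen ⊥ (w : RACG (Γ.induce {u | u ≠ v}) ⧸ linkSubgroup Γ v)) =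
      MulAut.conj (deleteHom Γ v w) (gen Γ v) := by
  refine (lift_gen _ _ _ _).trans ?_
  obtain ⟨h, hh⟩ := QuotientGroup.mk_out_eq_mul (linkSubgroup Γ v) w
  rw [hh, map_mul, map_mul, MulAut.mul_apply]
  congr 1
  rw [MulAut.conj_apply, (commute_deleteHom_of_mem Γ v h.2).eq, mul_inv_cancel_right]

lemma exists_injective_hom_semidirect :
    ∃ Φ : RACG Γ →*
      RACG (⊥ : SimpleGraph (RACG (Γ.induce {u | u ≠ v}) ⧸ linkSubgroup Γ v)) ⋊[permAut _ _]
        RACG (Γ.induce {u | u ≠ v}), Function.Injective Φ := by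
  classical
  let W' := RACG (Γ.induce {u | u ≠ v})
  let C := W' ⧸ linkSubgroup Γ v
  let G := RACG (⊥ : SimpleGraph C) ⋊[permAut W' C] W'
  let f : V → G := fun u => if h : u = v then SemidirectProduct.inl (gen ⊥ ((1 : W') : C))
    else SemidirectProduct.inr (gen _ (⟨u, h⟩ : {u | u ≠ v}))
  have hfv : f v = SemidirectProduct.inl (gen ⊥ ((1 : W') : C)) := dif_pos rfl
  have hfu (u : V) (h : u ≠ v) :
      f u = SemidirectProduct.inr (gen _ (⟨u, h⟩ : {u | u ≠ v})) := dif_neg h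
  have hvu (u : V) (h : u ≠ v) (hadj : Γ.Adj v u) : Commute (f u) (f v) := by
    rw [hfv, hfu u h]
    have hfix : gen (Γ.induce {u | u ≠ v}) ⟨u, h⟩ • ((1 : W') : C) = ((1 : W') : C) := by
      refine QuotientGroup.eq.2 ?_
      simp only [smul_eq_mul, mul_one]
      exact (linkSubgroup Γ v).inv_mem (Subgroup.subset_closure ⟨⟨u, h⟩, hadj, rfl⟩)
    have := SemidirectProduct.inl_aut (φ := permAut W' C) (gen _ (⟨u, h⟩ : {u | u ≠ v}))
      (gen ⊥ ((1 : W') : C))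
    rw [permAut_gen, hfix, map_inv] at this
    exact (mul_inv_eq_iff_eq_mul.1 this.symm)
  let Φ : RACG Γ →* G := lift f
    (fun u => by
      by_cases h : u = v
      · subst h
        rw [hfv, ← map_mul, gen_mul_self, map_one]
      · rw [hfu u h, ← map_mul, gen_mul_self, map_one])
    (fun u u' hadj => by
      by_cases h : u = v
      · subst h
        exact (hvu u' hadj.ne' hadj).symm
      · by_cases h' : u' = v
        · subst h'
          exact hvu u h hadj.symm
        · rw [hfu u h, hfu u' h']
          exact (gen_commute (Γ := Γ.induce {u | u ≠ v}) (u := ⟨u, h⟩) (v := ⟨u', h'⟩)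
            hadj).map SemidirectProduct.inr)
  let Ψ : G →* RACG Γ := SemidirectProduct.lift (cosetHom Γ v) (deleteHom Γ v) (by
    intro w
    refine hom_ext fun c => ?_
    induction c using QuotientGroup.induction_on with
    | H z =>
      change cosetHom Γ v (permAut W' C w (gen ⊥ (z : C))) =
        MulAut.conj (deleteHom Γ v w) (cosetHom Γ v (gen ⊥ (z : C)))
      rw [permAut_gen]
      change cosetHom Γ v (gen ⊥ ((w * z : W') : C)) = _
      rw [cosetHom_gen_mk, cosetHom_gen_mk, map_mul, map_mul, MulAut.mul_apply])
  have hΨΦ : Ψ.comp Φ = MonoidHom.id _ := by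
    refine hom_ext fun u => ?_
    change Ψ (Φ (gen Γ u)) = gen Γ u
    rw [show Φ (gen Γ u) = f u from lift_gen _ _ _ _]
    by_cases h : u = v
    · subst h
      rw [hfv, SemidirectProduct.lift_inl, cosetHom_gen_mk]
      simp
    · rw [hfu u h, SemidirectProduct.lift_inr, deleteHom_gen]
  exact ⟨Φ, Function.LeftInverse.injective (g := Ψ) (DFunLike.congr_fun hΨΦ)⟩

lemma exists_link_retraction :
    ∃ ρ : RACG (Γ.induce {u | u ≠ v}) →* RACG (Γ.induce {u | Γ.Adj v u}),
      ∀ w ∈ linkSubgroup Γ v, ρ w = 1 → w = 1 := by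
  classical
  let r : {u | u ≠ v} → RACG (Γ.induce {u | Γ.Adj v u}) :=
    fun u => if h : Γ.Adj v u then gen _ (⟨u, h⟩ : {u | Γ.Adj v u}) else 1
  let ρ : RACG (Γ.induce {u | u ≠ v}) →* RACG (Γ.induce {u | Γ.Adj v u}) := lift r
    (fun u => by
      simp only [r]
      split_ifs
      · exact gen_mul_self _
      · exact mul_one 1)
    (fun u u' hadj => by
      simp only [r]
      split_ifs with h h'
      · exact gen_commute (Γ := Γ.induce {u | Γ.Adj v u}) hadj
      all_goals simp)
  let ι : RACG (Γ.induce {u | Γ.Adj v u}) →* RACG (Γ.induce {u | u ≠ v}) :=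
    lift (fun u => gen _ (⟨u, u.2.ne'⟩ : {u | u ≠ v})) (fun _ => gen_mul_self _)
      (fun _ _ h => gen_commute (Γ := Γ.induce {u | u ≠ v}) h)
  have hιρ : ∀ w ∈ linkSubgroup Γ v, ι (ρ w) = w := by
    intro w hw
    induction hw using Subgroup.closure_induction with
    | mem x hx =>
      obtain ⟨u, hu, rfl⟩ := hx
      rw [show ρ (gen _ u) = gen _ (⟨u, hu⟩ : {u | Γ.Adj v u}) from
        (lift_gen _ _ _ _).trans (dif_pos hu)]
      exact lift_gen _ _ _ _
    | one => simp
    | mul x y _ _ hx hy => rw [map_mul, map_mul, hx, hy]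
    | inv x _ hx => rw [map_inv, map_inv, hx]
  refine ⟨ρ, fun w hw h => ?_⟩
  rw [← hιρ w hw, h, map_one]

end VertexSplitting

lemma isClique_map_subtype {t : Set V} {s : Finset t}
    (hs : (Γ.induce t).IsClique (s : Set t)) :
    Γ.IsClique (s.map (Function.Embedding.subtype (· ∈ t)) : Set V) := by
  rw [Finset.coe_map]
  rintro _ ⟨a, ha, rfl⟩ _ ⟨b, hb, rfl⟩ hab
  exact hs ha hb fun h => hab (congrArg _ h)

lemma card_le_of_isClique_induce {Γ : SimpleGraph V} {n : ℕ}
    (h : ∀ s : Finset V, Γ.IsClique (s : Set V) → s.card ≤ n) (t : Set V) (s : Finset t)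
    (hs : (Γ.induce t).IsClique (s : Set t)) : s.card ≤ n := by
  rw [← Finset.card_map (Function.Embedding.subtype _)]
  refine h _ ?_
  exact isClique_map_subtype hs

theorem card_dvd_two_pow_of_finite (k : ℕ) : ∀ {V : Type} [Finite V] (Γ : SimpleGraph V) (n : ℕ),
    Nat.card V ≤ k → (∀ s : Finset V, Γ.IsClique (s : Set V) → s.card ≤ n) →
    ∀ H : Subgroup (RACG Γ), Finite H → Nat.card H ∣ 2 ^ n := by
  induction k with
  | zero =>
    intro V _ Γ n hk _ H _
    have : IsEmpty V := (Nat.card_eq_zero.1 (Nat.le_zero.1 hk)).resolve_right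
      (not_infinite_iff_finite.2 ‹_›)
    have htriv : (⊤ : Subgroup (RACG Γ)) = ⊥ := by
      rw [← closure_range_gen, Set.range_eq_empty, Subgroup.closure_empty]
    have hH : H = ⊥ := eq_bot_iff.2 (htriv ▸ le_top)
    rw [hH, Subgroup.card_bot]
    exact one_dvd _
  | succ k ih =>
    intro V _ Γ n hk hn H _
    rcases isEmpty_or_nonempty V with hV | ⟨⟨v⟩⟩
    · exact ih Γ n (by simp) hn H ‹_›
    have hcard (t : Set V) (ht : v ∉ t) : Nat.card t ≤ k := by
      have : t.ncard < Nat.card V := Set.ncard_lt_card (fun h => ht (h ▸ Set.mem_univ v))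
      rw [Nat.card_coe_set_eq]
      omega
    obtain ⟨Φ, hΦ⟩ := exists_injective_hom_semidirect Γ v
    have : Finite (H.map Φ) := finite_map Φ H
    rw [← Subgroup.card_map_of_injective hΦ]
    rcases card_finite_subgroup_semidirect (H.map Φ) with h | ⟨c, h, hc⟩
    · rw [h]
      exact ih _ n (hcard _ (by simp)) (card_le_of_isClique_induce hn _) _ (finite_map _ _)
    · rw [h]
      set R := (H.map Φ).map SemidirectProduct.rightHom
      obtain ⟨w, rfl⟩ := QuotientGroup.mk_surjective c
      let conj := (MulAut.conj w⁻¹).toMonoidHom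
      have hR : R.map conj ≤ linkSubgroup Γ v := by
        rintro _ ⟨x, hx, rfl⟩
        have h1 := QuotientGroup.eq.1 (hc x hx)
        have h2 := (linkSubgroup Γ v).inv_mem h1
        simpa [conj, mul_assoc] using h2
      obtain ⟨ρ, hρ⟩ := exists_link_retraction Γ v
      rw [← Subgroup.card_map_of_injective (K := R) (f := conj) (MulAut.conj w⁻¹).injective,
        ← card_map_of_injOn ρ (R.map conj) fun x hx => hρ x (hR hx)]
      have hn1 : 1 ≤ n := by simpa using hn {v} (by simp)
      have hlink (s : Finset {u | Γ.Adj v u})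
          (hs : (Γ.induce {u | Γ.Adj v u}).IsClique (s : Set {u | Γ.Adj v u})) :
          s.card ≤ n - 1 := by
        classical
        have hv : v ∉ s.map (Function.Embedding.subtype _) := by simp
        have := hn (insert v (s.map (Function.Embedding.subtype _))) (by
          rw [Finset.coe_insert]
          refine (isClique_map_subtype hs).insert fun u hu _ => ?_
          obtain ⟨u, -, rfl⟩ := Finset.mem_map.1 hu
          exact u.2)
        rw [Finset.card_insert_of_notMem hv, Finset.card_map] at this
        omega
      have : Finite R := finite_map _ _
      have : Finite (R.map conj) := finite_map _ _
      have := ih _ (n - 1) (hcard _ (by simp)) hlink ((R.map conj).map ρ) (finite_map _ _)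
      obtain ⟨m, rfl⟩ : ∃ m, n = m + 1 := ⟨n - 1, by omega⟩
      rw [pow_succ']
      exact mul_dvd_mul_left 2 this

lemma exists_subgroup_card_eq_two_pow {s : Finset V} (hs : Γ.IsClique (s : Set V)) :
    ∃ H : Subgroup (RACG Γ), Finite H ∧ Nat.card H = 2 ^ s.card := by
  classical
  let f : (s → ℤˣ) →* RACG Γ :=
    MonoidHom.noncommPiCoprod (fun u : s => involutionHom (gen Γ u) (gen_mul_self _)) (by
      intro u u' huu' x y
      have hcomm : Commute (gen Γ u) (gen Γ u') :=
        gen_commute (hs u.2 u'.2 fun h => huu' (Subtype.ext h))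
      rcases Int.units_eq_one_or x with rfl | rfl <;>
        rcases Int.units_eq_one_or y with rfl | rfl <;>
        simp [involutionHom_neg_one, hcomm])
  let d : RACG Γ →* (s → ℤˣ) := MonoidHom.pi fun u => detect Γ u
  have hdf : d.comp f = MonoidHom.id _ := by
    refine MonoidHom.functions_ext _ _ _ fun u x => ?_
    rw [MonoidHom.comp_apply, MonoidHom.id_apply,
      show f (Pi.mulSingle u x) = involutionHom (gen Γ u) (gen_mul_self _) x from
        MonoidHom.noncommPiCoprod_mulSingle _ _ _]
    rcases Int.units_eq_one_or x with rfl | rfl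
    · simp
    · rw [involutionHom_neg_one]
      ext1 u'
      change detect Γ u' (gen Γ u) = _
      by_cases h : u = u'
      · subst h
        rw [detect_self, Pi.mulSingle_eq_same]
      · rw [detect_of_ne fun h' => h (Subtype.ext h'), Pi.mulSingle_eq_of_ne (Ne.symm h)]
  have hf : Function.Injective f :=
    Function.LeftInverse.injective (g := d) (DFunLike.congr_fun hdf)
  refine ⟨f.range, inferInstance, ?_⟩
  rw [Nat.card_congr (MonoidHom.ofInjective hf).symm.toEquiv]
  simp [Nat.card_eq_fintype_card]

end RACG

/-- if the largest clique of a finite graph `Γ` has exactly `n`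
vertices, then `lcm` of the orders of finite subgroups of `W_Γ` is `2^n`:
every finite subgroup has order dividing `2^n`, and there is a subgroup of
order exactly `2^n`. -/
theorem racg_lcm_of_finite_subgroups {V : Type} [Fintype V] (Γ : SimpleGraph V)
    (n : ℕ)
    (hbound : ∀ s : Finset V, Γ.IsClique (s : Set V) → s.card ≤ n)
    (hmax : ∃ s : Finset V, Γ.IsClique (s : Set V) ∧ s.card = n) :
    (∀ H : Subgroup (RACG Γ), Finite H → Nat.card H ∣ 2 ^ n) ∧
    (∃ H : Subgroup (RACG Γ), Finite H ∧ Nat.card H = 2 ^ n) := by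
  obtain ⟨s, hs, rfl⟩ := hmax
  exact ⟨RACG.card_dvd_two_pow_of_finite _ Γ _ le_rfl hbound,
    RACG.exists_subgroup_card_eq_two_pow hs⟩
end

section
/- Let Γ be a simple graph with finite vertex set V, let θ : W_{ΔΓ} → (ℤ/2ℤ)^V be the homomorphism determined on generators by θ(s) = e_s and θ(s') = e_s, and let ι : W_Γ → W_{ΔΓ} be the homomorphism determined on generators by ι(s) = s. Then ι is injective, and the intersection of the range of ι with ker(θ) equals ι([W_Γ, W_Γ]); that is, under the identification of W_Γ with its image, W_Γ ∩ ker(θ) is the commutator subgroup of W_Γ. -/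
/-- The graph `ΔΓ` on `V ⊔ V'`: edges `{s,t}` for each edge of `Γ`, `{s',t'}` for
all distinct `s,t`, and `{s,t'}` for all distinct `s,t`. -/
def deltaGraph {V : Type} (Γ : SimpleGraph V) : SimpleGraph (V ⊕ V) :=
  SimpleGraph.fromRel fun x y =>
    match x, y with
    | .inl s, .inl t => Γ.Adj s t
    | .inl s, .inr t => s ≠ t
    | .inr _, .inr _ => True
    | .inr _, .inl _ => False

namespace RACG

variable {V : Type} {Γ : SimpleGraph V}

theorem of_mul_self (s : V) :
    (PresentedGroup.of s : RACG Γ) * PresentedGroup.of s = 1 :=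
  PresentedGroup.one_of_mem (rels := racgRels Γ) (Or.inl ⟨s, rfl⟩)

theorem of_commute {s t : V} (h : Γ.Adj s t) :
    Commute (PresentedGroup.of s : RACG Γ) (PresentedGroup.of t) :=
  commutatorElement_eq_one_iff_commute.mp
    (PresentedGroup.one_of_mem (rels := racgRels Γ) (Or.inr ⟨s, t, h, rfl⟩))

theorem exists_hom {G : Type*} [Group G] (f : V → G) (hsq : ∀ s, f s * f s = 1)
    (hcomm : ∀ s t, Γ.Adj s t → Commute (f s) (f t)) :
    ∃ φ : RACG Γ →* G, ∀ s, φ (PresentedGroup.of s) = f s := by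
  have h : ∀ r ∈ racgRels Γ, FreeGroup.lift f r = 1 := by
    rintro r (⟨s, rfl⟩ | ⟨s, t, hst, rfl⟩)
    · simpa using hsq s
    · simpa [commutatorElement_def] using commutatorElement_eq_one_iff_commute.mpr (hcomm s t hst)
  exact ⟨PresentedGroup.toGroup h, fun _ => PresentedGroup.toGroup.of h⟩

/-- The standard inclusion into the group of `deltaGraph Γ` has a retraction, killing the
primed generators. -/
theorem exists_retraction (Γ : SimpleGraph V) :
    ∃ ρ : RACG (deltaGraph Γ) →* RACG Γ,
      ∀ s : V, ρ (PresentedGroup.of (Sum.inl s)) = PresentedGroup.of s := by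
  obtain ⟨ρ, hρ⟩ := exists_hom (Γ := deltaGraph Γ)
    (Sum.elim (fun s => (PresentedGroup.of s : RACG Γ)) fun _ => 1)
    (by rintro (s | s) <;> simp [of_mul_self])
    (by
      rintro (s | s) (t | t) h
      · rcases h with ⟨-, h | h⟩
        · exact of_commute h
        · exact (of_commute h).symm
      · exact Commute.one_right _
      · exact Commute.one_left _
      · exact Commute.one_left _)
  exact ⟨ρ, fun s => hρ (Sum.inl s)⟩

/-- The homomorphism out of `(ℤ/2ℤ)^V` sending the standard basis to given involutions. -/
def homOfInvolutions [Fintype V] {A : Type*} [CommGroup A] (a : V → A)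
    (ha : ∀ s, a s ^ 2 = 1) : Multiplicative (V → ZMod 2) →* A :=
  MonoidHom.mk' (fun v => ∏ s, a s ^ (v.toAdd s).val) fun v w => by
    rw [← Finset.prod_mul_distrib]
    refine Finset.prod_congr rfl fun s _ => ?_
    rw [toAdd_mul, Pi.add_apply, ZMod.val_add, ← pow_eq_pow_mod _ (ha s), pow_add]

theorem homOfInvolutions_single [Fintype V] [DecidableEq V] {A : Type*} [CommGroup A]
    (a : V → A) (ha : ∀ s, a s ^ 2 = 1) (s : V) :
    homOfInvolutions a ha (Multiplicative.ofAdd (Pi.single s 1)) = a s := by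
  change ∏ t, a t ^ ((Pi.single s 1 : V → ZMod 2) t).val = a s
  rw [Finset.prod_eq_single s]
  · simp [ZMod.val_one]
  · intro t _ hts
    simp [Pi.single_eq_of_ne hts]
  · simp

theorem ker_eq_commutator [Fintype V] [DecidableEq V]
    (f : RACG Γ →* Multiplicative (V → ZMod 2))
    (hf : ∀ s, f (PresentedGroup.of s) = Multiplicative.ofAdd (Pi.single s 1)) :
    f.ker = commutator (RACG Γ) := by
  refine le_antisymm ?_ (Abelianization.commutator_subset_ker f)
  let a : V → Abelianization (RACG Γ) := fun s => Abelianization.of (PresentedGroup.of s)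
  have ha : ∀ s, a s ^ 2 = 1 := fun s => by
    rw [pow_two, ← map_mul, of_mul_self, map_one]
  have hcomp : (homOfInvolutions a ha).comp f = Abelianization.of :=
    PresentedGroup.ext fun s => by
      rw [MonoidHom.comp_apply, hf, homOfInvolutions_single]
  intro w hw
  rw [← Abelianization.ker_of, ← hcomp, MonoidHom.mem_ker, MonoidHom.comp_apply,
    MonoidHom.mem_ker.mp hw, map_one]

end RACG

/-- the natural homomorphism `ι : W_Γ → W_{ΔΓ}`, `s ↦ s`, is
injective, and `ι(W_Γ) ∩ ker θ = ι([W_Γ, W_Γ])`, where `θ(s) = θ(s') = e_s`. -/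
theorem racg_inter_ker_theta_eq_commutator {V : Type} [Fintype V]
    [DecidableEq V] (Γ : SimpleGraph V)
    (θ : RACG (deltaGraph Γ) →* Multiplicative (V → ZMod 2))
    (hθ : ∀ s : V,
      θ (PresentedGroup.of (Sum.inl s)) = Multiplicative.ofAdd (Pi.single s 1) ∧
      θ (PresentedGroup.of (Sum.inr s)) = Multiplicative.ofAdd (Pi.single s 1))
    (ι : RACG Γ →* RACG (deltaGraph Γ))
    (hι : ∀ s : V, ι (PresentedGroup.of s) = PresentedGroup.of (Sum.inl s)) :
    Function.Injective ι ∧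
    ι.range ⊓ MonoidHom.ker θ = (commutator (RACG Γ)).map ι := by
  constructor
  · obtain ⟨ρ, hρ⟩ := RACG.exists_retraction Γ
    have hcomp : ρ.comp ι = MonoidHom.id _ :=
      PresentedGroup.ext fun s => by rw [MonoidHom.comp_apply, hι, hρ, MonoidHom.id_apply]
    exact Function.LeftInverse.injective (DFunLike.congr_fun hcomp)
  · have hker := RACG.ker_eq_commutator (θ.comp ι) fun s => by
      rw [MonoidHom.comp_apply, hι, (hθ s).1]
    rw [← hker, ← MonoidHom.comap_ker, Subgroup.map_comap_eq]
end
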